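/- Let ε be a splitting on a connected open set U ⊆ ℝⁿ. Then the groupoid curvature R vanishes identically on U × U if and only if the algebroid curvature 𝔯 vanishes identically on U. (The implication 𝔯 ≡ 0 ⇒ R ≡ 0 is the analogue of Lie's Third Fundamental Theorem: the Lie algebra has a Lie group.) -/

import Mathlib

noncomputable section

open Set

/-- The `j`-th coordinate partial derivative of a real-valued function on `ℝⁿ`. -/
noncomputable def pd {n : ℕ} (j : Fin n) (f : (Fin n → ℝ) → ℝ) (x : Fin n → ℝ) : ℝ :=
  fderiv ℝ f x (Pi.single j 1)

/-- A splitting `ε` on `U`: a smooth groupoid homomorphism `U × U → GL(n,ℝ)`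
satisfying `ε(z,y)ε(x,z) = ε(x,y)` and `ε(x,x) = id`. -/
structure IsSplitting {n : ℕ} (U : Set (Fin n → ℝ))
    (eps : (Fin n → ℝ) → (Fin n → ℝ) → Fin n → Fin n → ℝ) : Prop where
  smooth : ∀ i j : Fin n, ContDiffOn ℝ (⊤ : ℕ∞)
    (fun p : (Fin n → ℝ) × (Fin n → ℝ) => eps p.1 p.2 i j) (U ×ˢ U)
  comp : ∀ x ∈ U, ∀ y ∈ U, ∀ z ∈ U, ∀ i j : Fin n,
    (∑ a, eps z y i a * eps x z a j) = eps x y i j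
  refl : ∀ x ∈ U, ∀ i j : Fin n, eps x x i j = if i = j then (1 : ℝ) else 0

/-- `Γ^i_{jk}(x) = (∂ε^i_k(x,y)/∂y^j)|_{y=x}`. -/
noncomputable def Gam {n : ℕ} (eps : (Fin n → ℝ) → (Fin n → ℝ) → Fin n → Fin n → ℝ)
    (i j k : Fin n) (x : Fin n → ℝ) : ℝ :=
  pd j (fun y => eps x y i k) x

/-- The groupoid curvature `R^i_{jk}(x,y)`. -/
noncomputable def Rg {n : ℕ} (eps : (Fin n → ℝ) → (Fin n → ℝ) → Fin n → Fin n → ℝ)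
    (i j k : Fin n) (x y : Fin n → ℝ) : ℝ :=
  pd j (fun x' => eps x' y i k) x + ∑ a, pd a (fun y' => eps x y' i k) y * eps x y a j
    - pd k (fun x' => eps x' y i j) x - ∑ a, pd a (fun y' => eps x y' i j) y * eps x y a k

/-- The algebroid curvature `𝔯^i_{jk,r}(x)`. -/
noncomputable def ra {n : ℕ} (eps : (Fin n → ℝ) → (Fin n → ℝ) → Fin n → Fin n → ℝ)
    (i j k r : Fin n) (x : Fin n → ℝ) : ℝ :=
  pd j (Gam eps i r k) x + ∑ a, Gam eps a r j x * Gam eps i a k x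
    - pd k (Gam eps i r j) x - ∑ a, Gam eps a r k x * Gam eps i a j x

/-- The torsion `T^i_{jk} = Γ^i_{jk} − Γ^i_{kj}`. -/
noncomputable def Tor {n : ℕ} (eps : (Fin n → ℝ) → (Fin n → ℝ) → Fin n → Fin n → ℝ)
    (i j k : Fin n) (x : Fin n → ℝ) : ℝ :=
  Gam eps i j k x - Gam eps i k j x

/-- A vector field `ξ` is `ε`-parallel if `ξ^i(y) = ε^i_a(x,y) ξ^a(x)` for all `x, y ∈ U`. -/
def EpsParallelVF {n : ℕ} (U : Set (Fin n → ℝ))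
    (eps : (Fin n → ℝ) → (Fin n → ℝ) → Fin n → Fin n → ℝ)
    (ξ : (Fin n → ℝ) → Fin n → ℝ) : Prop :=
  ∀ x ∈ U, ∀ y ∈ U, ∀ i, ξ y i = ∑ a, eps x y i a * ξ x a

theorem pd_sum_mul {n : ℕ} {ι : Type*} [Fintype ι] (r : Fin n) {f g : ι → (Fin n → ℝ) → ℝ}
    {x : Fin n → ℝ} (hf : ∀ a, DifferentiableAt ℝ (f a) x)
    (hg : ∀ a, DifferentiableAt ℝ (g a) x) :
    pd r (fun y => ∑ a, f a y * g a y) x = ∑ a, (pd r (f a) x * g a x + f a x * pd r (g a) x) := by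
  unfold pd
  rw [fderiv_fun_sum fun a _ => (hf a).fun_mul (hg a), _root_.sum_apply]
  refine Finset.sum_congr rfl fun a _ => ?_
  rw [fderiv_fun_mul (hf a) (hg a)]
  simp
  ring

theorem pd_sum_mul_const {n : ℕ} {ι : Type*} [Fintype ι] (r : Fin n) {f : ι → (Fin n → ℝ) → ℝ}
    (c : ι → ℝ) {x : Fin n → ℝ} (hf : ∀ a, DifferentiableAt ℝ (f a) x) :
    pd r (fun y => ∑ a, f a y * c a) x = ∑ a, pd r (f a) x * c a := by
  rw [pd_sum_mul r hf fun a => differentiableAt_const (c a)]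
  simp [pd]

theorem pd_congr {n : ℕ} (r : Fin n) {f g : (Fin n → ℝ) → ℝ} {U : Set (Fin n → ℝ)}
    (hU : IsOpen U) {x : Fin n → ℝ} (hx : x ∈ U) (h : EqOn f g U) : pd r f x = pd r g x := by
  unfold pd
  rw [Filter.EventuallyEq.fderiv_eq (h.eventuallyEq_of_mem (hU.mem_nhds hx))]

theorem pd_sub {n : ℕ} (r : Fin n) {f g : (Fin n → ℝ) → ℝ} {x : Fin n → ℝ}
    (hf : DifferentiableAt ℝ f x) (hg : DifferentiableAt ℝ g x) :
    pd r (fun y => f y - g y) x = pd r f x - pd r g x := by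
  simp [pd, fderiv_fun_sub hf hg]

theorem fderiv_eq_zero_of_pd {n : ℕ} {f : (Fin n → ℝ) → ℝ} {x : Fin n → ℝ}
    (h : ∀ r, pd r f x = 0) : fderiv ℝ f x = 0 := by
  refine ContinuousLinearMap.coe_injective (LinearMap.pi_ext' fun r => ?_)
  ext
  simpa [pd] using h r

theorem ContDiffAt.pd {n : ℕ} (r : Fin n) {f : (Fin n → ℝ) → ℝ} {x : Fin n → ℝ}
    (hf : ContDiffAt ℝ (⊤ : ℕ∞) f x) : ContDiffAt ℝ (⊤ : ℕ∞) (_root_.pd r f) x :=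
  (hf.fderiv_right (m := (⊤ : ℕ∞)) (by simp)).clm_apply contDiffAt_const

theorem pd_comm {n : ℕ} (r s : Fin n) {f : (Fin n → ℝ) → ℝ} {x : Fin n → ℝ}
    (hf : ContDiffAt ℝ (⊤ : ℕ∞) f x) : pd r (pd s f) x = pd s (pd r f) x := by
  have hd : DifferentiableAt ℝ (fderiv ℝ f) x :=
    (hf.fderiv_right (m := (⊤ : ℕ∞)) (by simp)).differentiableAt (by simp)
  have key (r s : Fin n) :
      pd r (pd s f) x = fderiv ℝ (fderiv ℝ f) x (Pi.single r 1) (Pi.single s 1) := by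
    change fderiv ℝ (fun y => fderiv ℝ f y (Pi.single s 1)) x (Pi.single r 1) = _
    rw [fderiv_clm_apply hd (differentiableAt_const _)]
    simp
  rw [key, key]
  exact hf.isSymmSndFDerivAt (by simpa using WithTop.coe_le_coe.2 (le_top (a := (2 : ℕ∞)))) _ _

/-- The torsion as a bilinear operation on tangent vectors at `y`. -/
def torsionApply {n : ℕ} (eps : (Fin n → ℝ) → (Fin n → ℝ) → Fin n → Fin n → ℝ)
    (y u v : Fin n → ℝ) : Fin n → ℝ :=
  fun i => ∑ a, ∑ b, Tor eps i a b y * (u a * v b)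

/-- Transport of a tangent vector from `x` to `y` along the splitting. -/
def transport {n : ℕ} (eps : (Fin n → ℝ) → (Fin n → ℝ) → Fin n → Fin n → ℝ)
    (x y u : Fin n → ℝ) : Fin n → ℝ :=
  (Matrix.of (eps x y)).mulVec u

/-- The groupoid curvature as a bilinear operation on tangent vectors at `x`. -/
def curvatureApply {n : ℕ} (eps : (Fin n → ℝ) → (Fin n → ℝ) → Fin n → Fin n → ℝ)
    (x y u v : Fin n → ℝ) : Fin n → ℝ :=
  fun i => ∑ j, ∑ k, Rg eps i j k x y * (u j * v k)

namespace IsSplitting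

variable {n : ℕ} {U : Set (Fin n → ℝ)}
  {eps : (Fin n → ℝ) → (Fin n → ℝ) → Fin n → Fin n → ℝ}

theorem contDiffAt_right (h : IsSplitting U eps) (hU : IsOpen U) {x y : Fin n → ℝ} (hx : x ∈ U)
    (hy : y ∈ U) (i j : Fin n) : ContDiffAt ℝ (⊤ : ℕ∞) (fun y' => eps x y' i j) y :=
  ((h.smooth i j).contDiffAt ((hU.prod hU).mem_nhds ⟨hx, hy⟩)).comp y
    (contDiffAt_const.prodMk contDiffAt_id)

theorem contDiffAt_left (h : IsSplitting U eps) (hU : IsOpen U) {x y : Fin n → ℝ} (hx : x ∈ U)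
    (hy : y ∈ U) (i j : Fin n) : ContDiffAt ℝ (⊤ : ℕ∞) (fun x' => eps x' y i j) x :=
  ((h.smooth i j).contDiffAt ((hU.prod hU).mem_nhds ⟨hx, hy⟩)).comp x
    (contDiffAt_id.prodMk contDiffAt_const)

theorem differentiableAt_right (h : IsSplitting U eps) (hU : IsOpen U) {x y : Fin n → ℝ}
    (hx : x ∈ U) (hy : y ∈ U) (i j : Fin n) : DifferentiableAt ℝ (fun y' => eps x y' i j) y :=
  (h.contDiffAt_right hU hx hy i j).differentiableAt (by simp)

theorem differentiableAt_left (h : IsSplitting U eps) (hU : IsOpen U) {x y : Fin n → ℝ}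
    (hx : x ∈ U) (hy : y ∈ U) (i j : Fin n) : DifferentiableAt ℝ (fun x' => eps x' y i j) x :=
  (h.contDiffAt_left hU hx hy i j).differentiableAt (by simp)

theorem pd_right (h : IsSplitting U eps) (hU : IsOpen U) {x y : Fin n → ℝ} (hx : x ∈ U)
    (hy : y ∈ U) (r i k : Fin n) :
    pd r (fun y' => eps x y' i k) y = ∑ m, Gam eps i r m y * eps x y m k := by
  rw [pd_congr r hU hy fun y' hy' => (h.comp x hx y' hy' y hy i k).symm,
    pd_sum_mul_const r (fun a => eps x y a k) fun a => h.differentiableAt_right hU hy hy i a]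
  rfl

theorem pd_left (h : IsSplitting U eps) (hU : IsOpen U) {x y : Fin n → ℝ} (hx : x ∈ U)
    (hy : y ∈ U) (r i k : Fin n) :
    pd r (fun x' => eps x' y i k) x = -∑ m, eps x y i m * Gam eps m r k x := by
  have h0 : pd r (fun x' => ∑ a, eps x' y i a * eps x x' a k) x = 0 := by
    rw [pd_congr r hU hx fun x' hx' => h.comp x hx y hy x' hx' i k]
    simp [pd]
  rw [pd_sum_mul r (fun a => h.differentiableAt_left hU hx hy i a)
    fun a => h.differentiableAt_right hU hx hx a k, Finset.sum_add_distrib] at h0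
  simp only [h.refl x hx, mul_ite, mul_one, mul_zero, Finset.sum_ite_eq', Finset.mem_univ,
    if_true] at h0
  exact eq_neg_of_add_eq_zero_left h0

theorem Gam_eq (h : IsSplitting U eps) (hU : IsOpen U) {x y : Fin n → ℝ} (hx : x ∈ U)
    (hy : y ∈ U) (i r k : Fin n) :
    Gam eps i r k y = ∑ m, pd r (fun y' => eps x y' i m) y * eps y x m k := by
  rw [Gam, pd_congr r hU hy fun y' hy' => (h.comp y hy y' hy' x hx i k).symm,
    pd_sum_mul_const r (fun a => eps y x a k) fun a => h.differentiableAt_right hU hx hy i a]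

theorem differentiableAt_Gam (h : IsSplitting U eps) (hU : IsOpen U) {x : Fin n → ℝ}
    (hx : x ∈ U) (i r k : Fin n) : DifferentiableAt ℝ (Gam eps i r k) x := by
  have hd : DifferentiableAt ℝ
      (fun y => ∑ m, pd r (fun y' => eps x y' i m) y * eps y x m k) x :=
    DifferentiableAt.fun_sum fun m _ =>
      (((h.contDiffAt_right hU hx hx i m).pd r).differentiableAt (by simp)).mul
        (h.differentiableAt_left hU hx hx m k)
  exact hd.congr_of_eventuallyEq
    (EqOn.eventuallyEq_of_mem (fun y hy => h.Gam_eq hU hx hy i r k) (hU.mem_nhds hx))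

theorem differentiableAt_Tor (h : IsSplitting U eps) (hU : IsOpen U) {x : Fin n → ℝ}
    (hx : x ∈ U) (i j k : Fin n) : DifferentiableAt ℝ (Tor eps i j k) x :=
  (h.differentiableAt_Gam hU hx i j k).sub (h.differentiableAt_Gam hU hx i k j)

theorem pd_Gam (h : IsSplitting U eps) (hU : IsOpen U) {x : Fin n → ℝ} (hx : x ∈ U)
    (j i r k : Fin n) :
    pd j (Gam eps i r k) x =
      pd j (pd r fun y => eps x y i k) x - ∑ m, Gam eps i r m x * Gam eps m j k x := by
  rw [pd_congr j hU hx fun y hy => h.Gam_eq hU hx hy i r k,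
    pd_sum_mul j (fun m => ((h.contDiffAt_right hU hx hx i m).pd r).differentiableAt (by simp))
      fun m => h.differentiableAt_left hU hx hx m k, Finset.sum_add_distrib]
  simp only [h.pd_left hU hx hx, h.refl x hx, mul_ite, mul_one, mul_zero, ite_mul, one_mul,
    zero_mul, Finset.sum_ite_eq, Finset.sum_ite_eq', Finset.mem_univ, if_true, mul_neg,
    Finset.sum_neg_distrib]
  rfl

/-- The connection with coefficients `Gam` is flat. -/
theorem pd_Gam_sub_pd_Gam (h : IsSplitting U eps) (hU : IsOpen U) {x : Fin n → ℝ} (hx : x ∈ U)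
    (j i r k : Fin n) :
    pd j (Gam eps i r k) x - pd r (Gam eps i j k) x =
      ∑ m, Gam eps i j m x * Gam eps m r k x - ∑ m, Gam eps i r m x * Gam eps m j k x := by
  rw [h.pd_Gam hU hx, h.pd_Gam hU hx, pd_comm j r (h.contDiffAt_right hU hx hx i k)]
  ring

/-- The algebroid curvature is the covariant derivative of the torsion. -/
theorem ra_eq (h : IsSplitting U eps) (hU : IsOpen U) {x : Fin n → ℝ} (hx : x ∈ U)
    (i j k r : Fin n) :
    ra eps i j k r x = pd r (Tor eps i j k) x - ∑ a, Gam eps i r a x * Tor eps a j k x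
      + ∑ a, Tor eps i j a x * Gam eps a r k x + ∑ a, Tor eps i a k x * Gam eps a r j x := by
  have hT : pd r (Tor eps i j k) x = pd r (Gam eps i j k) x - pd r (Gam eps i k j) x :=
    pd_sub r (h.differentiableAt_Gam hU hx i j k) (h.differentiableAt_Gam hU hx i k j)
  have h1 := h.pd_Gam_sub_pd_Gam hU hx j i r k
  have h2 := h.pd_Gam_sub_pd_Gam hU hx k i r j
  rw [ra, hT]
  simp only [Tor, mul_sub, sub_mul, Finset.sum_sub_distrib, mul_comm (Gam eps _ r j x),
    mul_comm (Gam eps _ r k x)] at h1 h2 ⊢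
  linarith

/-- The groupoid curvature measures the failure of `eps` to preserve the torsion. -/
theorem Rg_eq (h : IsSplitting U eps) (hU : IsOpen U) {x y : Fin n → ℝ} (hx : x ∈ U)
    (hy : y ∈ U) (i j k : Fin n) :
    Rg eps i j k x y = ∑ a, ∑ b, Tor eps i a b y * (eps x y a j * eps x y b k)
      - ∑ a, eps x y i a * Tor eps a j k x := by
  have hs : ∑ a, (∑ m, Gam eps i a m y * eps x y m j) * eps x y a k
      = ∑ a, ∑ b, Gam eps i b a y * (eps x y a j * eps x y b k) := by
    simp only [Finset.sum_mul]
    rw [Finset.sum_comm]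
    simp only [mul_assoc]
  have hs' : ∑ a, (∑ m, Gam eps i a m y * eps x y m k) * eps x y a j
      = ∑ a, ∑ b, Gam eps i a b y * (eps x y a j * eps x y b k) := by
    simp only [Finset.sum_mul]
    exact Finset.sum_congr rfl fun a _ => Finset.sum_congr rfl fun b _ => by ring
  simp only [Rg, h.pd_left hU hx hy, h.pd_right hU hx hy, hs, hs', Tor, sub_mul, mul_sub,
    Finset.sum_sub_distrib]
  ring

theorem Rg_self (h : IsSplitting U eps) (hU : IsOpen U) {x : Fin n → ℝ} (hx : x ∈ U)
    (i j k : Fin n) : Rg eps i j k x x = 0 := by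
  simp [h.Rg_eq hU hx hx, h.refl x hx]

theorem differentiableAt_Rg (h : IsSplitting U eps) (hU : IsOpen U) {x y : Fin n → ℝ}
    (hx : x ∈ U) (hy : y ∈ U) (i j k : Fin n) : DifferentiableAt ℝ (Rg eps i j k x) y := by
  refine DifferentiableAt.congr_of_eventuallyEq ?_
    (EqOn.eventuallyEq_of_mem (fun z hz => h.Rg_eq hU hx hz i j k) (hU.mem_nhds hy))
  have hr := h.differentiableAt_right hU hx hy
  have hT := h.differentiableAt_Tor hU hy
  exact (DifferentiableAt.fun_sum fun a _ => DifferentiableAt.fun_sum fun b _ =>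
      (hT i a b).mul ((hr a j).mul (hr b k))).sub
    (DifferentiableAt.fun_sum fun a _ => (hr i a).mul (differentiableAt_const _))

/-- The algebroid curvature is the linearization of the groupoid curvature along the diagonal. -/
theorem pd_Rg_self (h : IsSplitting U eps) (hU : IsOpen U) {x : Fin n → ℝ} (hx : x ∈ U)
    (i j k r : Fin n) : pd r (Rg eps i j k x) x = ra eps i j k r x := by
  have hr := h.differentiableAt_right hU hx hx
  have hT := h.differentiableAt_Tor hU hx
  have hp (i k : Fin n) : pd r (fun y => eps x y i k) x = Gam eps i r k x := rfl
  have hprod (a b : Fin n) : pd r (fun y => eps x y a j * eps x y b k) x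
      = Gam eps a r j x * eps x x b k + eps x x a j * Gam eps b r k x := by
    simpa [hp] using pd_sum_mul (ι := Unit) r (fun _ => hr a j) (fun _ => hr b k)
  rw [pd_congr r hU hx fun y hy => h.Rg_eq hU hx hy i j k]
  simp only [← Fintype.sum_prod_type']
  rw [pd_sub r, pd_sum_mul r, pd_sum_mul_const r, h.ra_eq hU hx, Fintype.sum_prod_type]
  · simp only [hprod, hp, h.refl x hx]
    simp [Finset.sum_add_distrib, mul_add]
    ring
  · exact fun a => hr i a
  · exact fun p => hT i p.1 p.2
  · exact fun p => (hr p.1 j).mul (hr p.2 k)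
  · exact DifferentiableAt.fun_sum fun p _ => (hT i p.1 p.2).mul ((hr p.1 j).mul (hr p.2 k))
  · exact DifferentiableAt.fun_sum fun a _ => (hr i a).mul (differentiableAt_const _)

theorem curvatureApply_eq (h : IsSplitting U eps) (hU : IsOpen U) {x y : Fin n → ℝ}
    (hx : x ∈ U) (hy : y ∈ U) (u v : Fin n → ℝ) :
    curvatureApply eps x y u v =
      torsionApply eps y (transport eps x y u) (transport eps x y v)
        - transport eps x y (torsionApply eps x u v) := by
  ext i
  have h1 : ∑ j, ∑ k, (∑ a, ∑ b, Tor eps i a b y * (eps x y a j * eps x y b k)) * (u j * v k)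
      = torsionApply eps y (transport eps x y u) (transport eps x y v) i := by
    simp only [torsionApply, transport, Matrix.mulVec, dotProduct, Matrix.of_apply,
      Finset.mul_sum, Finset.sum_mul, ← Fintype.sum_prod_type']
    exact Fintype.sum_equiv ⟨fun p => (p.2.2.1, p.2.2.2, p.2.1, p.1),
      fun p => (p.2.2.2, p.2.2.1, p.1, p.2.1), fun _ => rfl, fun _ => rfl⟩ _ _ fun _ => by
        dsimp only [Equiv.coe_fn_mk]
        ring
  have h2 : ∑ j, ∑ k, (∑ a, eps x y i a * Tor eps a j k x) * (u j * v k)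
      = transport eps x y (torsionApply eps x u v) i := by
    simp only [torsionApply, transport, Matrix.mulVec, dotProduct, Matrix.of_apply,
      Finset.mul_sum, Finset.sum_mul, ← Fintype.sum_prod_type']
    exact Fintype.sum_equiv ⟨fun p => (p.2.2, p.1, p.2.1), fun p => (p.2.1, p.2.2, p.1),
      fun _ => rfl, fun _ => rfl⟩ _ _ fun _ => by
        dsimp only [Equiv.coe_fn_mk]
        ring
  simp only [curvatureApply, h.Rg_eq hU hx hy, sub_mul, Finset.sum_sub_distrib, h1, h2,
    Pi.sub_apply]

theorem transport_transport (h : IsSplitting U eps) {x y z : Fin n → ℝ} (hx : x ∈ U)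
    (hy : y ∈ U) (hz : z ∈ U) (u : Fin n → ℝ) :
    transport eps y z (transport eps x y u) = transport eps x z u := by
  rw [transport, transport, Matrix.mulVec_mulVec]
  congr 1
  ext i j
  exact h.comp x hx z hz y hy i j

theorem transport_self (h : IsSplitting U eps) {x : Fin n → ℝ} (hx : x ∈ U) (u : Fin n → ℝ) :
    transport eps x x u = u := by
  have : Matrix.of (eps x x) = 1 := by
    ext i j
    simp [h.refl x hx, Matrix.one_apply]
  rw [transport, this, Matrix.one_mulVec]

/-- The groupoid curvature is a cocycle. -/
theorem curvatureApply_cocycle (h : IsSplitting U eps) (hU : IsOpen U) {x y z : Fin n → ℝ}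
    (hx : x ∈ U) (hy : y ∈ U) (hz : z ∈ U) (u v : Fin n → ℝ) :
    curvatureApply eps x z u v =
      curvatureApply eps y z (transport eps x y u) (transport eps x y v)
        + transport eps y z (curvatureApply eps x y u v) := by
  have hsub (a b : Fin n → ℝ) :
      transport eps y z (a - b) = transport eps y z a - transport eps y z b :=
    Matrix.mulVec_sub _ _ _
  rw [h.curvatureApply_eq hU hx hz, h.curvatureApply_eq hU hy hz,
    h.curvatureApply_eq hU hx hy, hsub]
  simp only [h.transport_transport hx hy hz]
  abel

theorem hasFDerivAt_curvatureApply_pullback (h : IsSplitting U eps) (hU : IsOpen U)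
    (hra : ∀ x ∈ U, ∀ i j k r : Fin n, ra eps i j k r x = 0) {x y : Fin n → ℝ} (hx : x ∈ U)
    (hy : y ∈ U) (u v : Fin n → ℝ) (c : Fin n) :
    HasFDerivAt (fun z => transport eps z x (curvatureApply eps x z u v) c)
      (0 : (Fin n → ℝ) →L[ℝ] ℝ) y := by
  have hR (i j k : Fin n) : HasFDerivAt (Rg eps i j k y) (0 : (Fin n → ℝ) →L[ℝ] ℝ) y := by
    have h0 : fderiv ℝ (Rg eps i j k y) y = 0 :=
      fderiv_eq_zero_of_pd fun r => by rw [h.pd_Rg_self hU hy, hra y hy]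
    exact h0 ▸ (h.differentiableAt_Rg hU hy hy i j k).hasFDerivAt
  have hW (u v : Fin n → ℝ) (i : Fin n) :
      HasFDerivAt (fun z => curvatureApply eps y z u v i) (0 : (Fin n → ℝ) →L[ℝ] ℝ) y := by
    simpa [curvatureApply] using HasFDerivAt.fun_sum (u := Finset.univ) fun j _ =>
      HasFDerivAt.fun_sum (u := Finset.univ) fun k _ => (hR i j k).mul_const (u j * v k)
  have hW0 (u v : Fin n → ℝ) (i : Fin n) : curvatureApply eps y y u v i = 0 := by
    simp [curvatureApply, h.Rg_self hU hy]
  have hP (u v : Fin n → ℝ) : HasFDerivAt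
      (fun z => transport eps z x (curvatureApply eps y z u v) c)
      (0 : (Fin n → ℝ) →L[ℝ] ℝ) y := by
    simpa [transport, Matrix.mulVec, dotProduct, hW0] using HasFDerivAt.fun_sum (u := Finset.univ) fun i _ =>
      (h.differentiableAt_left hU hy hx c i).hasFDerivAt.mul (hW u v i)
  refine ((hP (transport eps x y u) (transport eps x y v)).add_const
    (transport eps y x (curvatureApply eps x y u v) c)).congr_of_eventuallyEq
    (EqOn.eventuallyEq_of_mem (fun z hz => ?_) (hU.mem_nhds hy))
  have hadd (a b : Fin n → ℝ) :
      transport eps z x (a + b) = transport eps z x a + transport eps z x b :=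
    Matrix.mulVec_add _ _ _
  simp only [h.curvatureApply_cocycle hU hx hy hz, hadd, h.transport_transport hy hz hx,
    Pi.add_apply]

theorem curvatureApply_eq_zero (h : IsSplitting U eps) (hU : IsOpen U) (hUc : IsPreconnected U)
    (hra : ∀ x ∈ U, ∀ i j k r : Fin n, ra eps i j k r x = 0) {x y : Fin n → ℝ} (hx : x ∈ U)
    (hy : y ∈ U) (u v : Fin n → ℝ) : curvatureApply eps x y u v = 0 := by
  have hP : transport eps y x (curvatureApply eps x y u v) = 0 := by
    ext c
    have hd {z : Fin n → ℝ} (hz : z ∈ U) :=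
      h.hasFDerivAt_curvatureApply_pullback hU hra hx hz u v c
    rw [hU.is_const_of_fderiv_eq_zero (𝕜 := ℝ) hUc
      (fun z hz => (hd hz).differentiableAt.differentiableWithinAt)
      (fun z hz => (hd hz).fderiv) hy hx, h.transport_self hx]
    simp [curvatureApply, h.Rg_self hU hx]
  rw [← h.transport_self hy (curvatureApply eps x y u v), ← h.transport_transport hy hx hy, hP]
  exact Matrix.mulVec_zero _

end IsSplitting

/-- `R ≡ 0` on `U × U` iff `𝔯 ≡ 0` on `U` (Lie's Third Fundamental
Theorem in the nontrivial direction). -/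
theorem stmt_7 {n : ℕ} (hn : 2 ≤ n) (U : Set (Fin n → ℝ)) (hU : IsOpen U)
    (hUconn : IsConnected U)
    (eps : (Fin n → ℝ) → (Fin n → ℝ) → Fin n → Fin n → ℝ) (heps : IsSplitting U eps) :
    (∀ x ∈ U, ∀ y ∈ U, ∀ i j k : Fin n, Rg eps i j k x y = 0) ↔
      (∀ x ∈ U, ∀ i j k r : Fin n, ra eps i j k r x = 0) := by
  refine ⟨fun hR x hx i j k r => ?_, fun hra x hx y hy i j k => ?_⟩
  · rw [← heps.pd_Rg_self hU hx, pd_congr r hU hx fun y hy => hR x hx y hy i j k]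
    simp [pd]
  · simpa [curvatureApply, Pi.single_apply] using congrFun
      (heps.curvatureApply_eq_zero hU hUconn.isPreconnected hra hx hy (Pi.single j 1)
        (Pi.single k 1)) i
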